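/- Let $c>0$ and $n>c$ be real numbers, and define $S_{n,c}(x)=\sum_{k=0}^{\infty}\left(\frac{(n/c)_k}{k!}(cx)^k(1+cx)^{-n/c-k}\right)^2$ for $x\ge0$, where $(a)_k$ is the ascending Pochhammer symbol. Then for all $x\ge0$, $S_{n,c}(x)=\frac{1}{\pi}\int_0^1\big(t+(1-t)(1+2cx)^2\big)^{-n/c}\,\frac{dt}{\sqrt{t(1-t)}}$. -/

import Mathlib

open Complex in
theorem integral_exp_int_mul_I (m : ℤ) :
    ∫ θ in (0 : ℝ)..2 * Real.pi, exp (m * I * θ) = if m = 0 then (2 * Real.pi : ℂ) else 0 := by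
  split_ifs with hm
  · simp [hm]
  · rw [integral_exp_mul_complex (by simp [hm])]
    have : exp (m * I * (2 * Real.pi : ℝ)) = 1 := by
      rw [← exp_int_mul_two_pi_mul_I m]
      push_cast
      ring_nf
    rw [this]
    simp

open Complex in
/-- **Parseval's identity** for an absolutely convergent power series on the unit circle. -/
theorem hasSum_sq_norm_of_summable_norm {b : ℕ → ℂ} (hb : Summable fun k ↦ ‖b k‖) {F : ℝ → ℂ}
    (hF : ∀ θ : ℝ, HasSum (fun k ↦ b k * exp (θ * I) ^ k) (F θ)) :
    HasSum (fun k ↦ ‖b k‖ ^ 2) ((2 * Real.pi)⁻¹ * ∫ θ in (0 : ℝ)..2 * Real.pi, ‖F θ‖ ^ 2) := by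
  have hprod : Summable fun p : ℕ × ℕ ↦ ‖b p.1‖ * ‖b p.2‖ :=
    hb.mul_of_nonneg hb (fun _ ↦ norm_nonneg _) fun _ ↦ norm_nonneg _
  let u : ℕ × ℕ → ℝ → ℂ := fun p θ ↦
    b p.1 * (starRingEnd ℂ) (b p.2) * exp (((p.1 : ℤ) - (p.2 : ℤ) : ℤ) * I * θ)
  have hu : ∀ p θ, u p θ =
      (b p.1 * exp (θ * I) ^ p.1) * (starRingEnd ℂ) (b p.2 * exp (θ * I) ^ p.2) := by
    intro p θ
    simp only [u, map_mul, ← exp_conj, ← exp_nat_mul, conj_ofReal, conj_I, map_natCast]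
    rw [show ∀ x y z w : ℂ, x * z * (y * w) = x * y * (z * w) by intros; ring, ← exp_add]
    congr 2
    push_cast
    ring
  have hnorm : ∀ p θ, ‖u p θ‖ = ‖b p.1‖ * ‖b p.2‖ := by
    intro p θ
    simp [hu, norm_exp_ofReal_mul_I]
  have hsum : ∀ θ, HasSum (fun p ↦ u p θ) ((‖F θ‖ ^ 2 : ℝ) : ℂ) := by
    intro θ
    have h1 := hF θ
    have h2 := hasSum_conj'.2 h1
    have := h1.mul h2 ((summable_congr fun p ↦ (hu p θ)).1
      (.of_norm (by simpa only [hnorm] using hprod)))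
    rw [mul_conj, normSq_eq_norm_sq] at this
    simpa only [hu] using this
  have hint := intervalIntegral.hasSum_integral_of_dominated_convergence (μ := MeasureTheory.volume)
    (a := 0) (b := 2 * Real.pi) (F := u) (f := fun θ ↦ ((‖F θ‖ ^ 2 : ℝ) : ℂ))
    (fun p _ ↦ ‖b p.1‖ * ‖b p.2‖)
    (fun p ↦ (by fun_prop : Continuous (u p)).aestronglyMeasurable)
    (fun p ↦ .of_forall fun θ _ ↦ (hnorm p θ).le) (.of_forall fun _ _ ↦ hprod)
    intervalIntegrable_const (.of_forall fun θ _ ↦ hsum θ)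
  have hval : ∀ p : ℕ × ℕ, ∫ θ in (0 : ℝ)..2 * Real.pi, u p θ =
      if p.1 = p.2 then 2 * Real.pi * (b p.1 * (starRingEnd ℂ) (b p.2)) else 0 := by
    intro p
    simp only [u, intervalIntegral.integral_const_mul]
    rw [integral_exp_int_mul_I]
    simp only [sub_eq_zero, Nat.cast_inj]
    split_ifs <;> ring
  have hdiag : Function.Injective fun k : ℕ ↦ (k, k) := fun i j h ↦ congrArg Prod.fst h
  rw [← hdiag.hasSum_iff] at hint
  · rw [intervalIntegral.integral_ofReal] at hint
    have hcoeff : (fun p ↦ ∫ θ in (0 : ℝ)..2 * Real.pi, u p θ) ∘ (fun k ↦ (k, k)) =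
        fun k ↦ ((2 * Real.pi * ‖b k‖ ^ 2 : ℝ) : ℂ) :=
      funext fun k ↦ by simp [hval, mul_conj, normSq_eq_norm_sq]
    rw [hcoeff] at hint
    have hre := hasSum_ofReal.1 hint
    have := hre.mul_left (2 * Real.pi)⁻¹
    simpa [← mul_assoc, Real.pi_ne_zero] using this
  · rintro ⟨i, j⟩ hij
    rw [hval, if_neg]
    exact fun h ↦ hij ⟨i, Prod.ext rfl h⟩

theorem Ring.choose_add_natCast_sub_one (a : ℝ) (k : ℕ) :
    Ring.choose (a + k - 1) k = (ascPochhammer ℝ k).eval a / (k.factorial : ℝ) := by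
  have h := Ring.factorial_nsmul_multichoose_eq_ascPochhammer a k
  rw [Polynomial.ascPochhammer_smeval_eq_eval, nsmul_eq_mul] at h
  rw [eq_div_iff (by positivity), ← h, Ring.choose, mul_comm]
  congr 2
  ring

theorem integral_comp_cos_eq_integral_div_sqrt (g : ℝ → ℝ) :
    ∫ θ in (0 : ℝ)..Real.pi, g ((1 + Real.cos θ) / 2) =
      ∫ t in (0 : ℝ)..1, g t / √(t * (1 - t)) := by
  have h := Polynomial.Chebyshev.integral_measureT_eq_integral_cos (f := fun u ↦ g ((1 + u) / 2))
  rw [Polynomial.Chebyshev.integral_measureT] at h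
  simp only [Real.sqrt_inv] at h
  rw [← h]
  have h2 := intervalIntegral.smul_integral_comp_mul_add
    (fun x ↦ g ((1 + x) / 2) * (√(1 - x ^ 2))⁻¹) 2 (-1) (a := 0) (b := 1)
  norm_num at h2
  rw [← h2, ← intervalIntegral.integral_const_mul]
  congr with t
  have : 1 - (2 * t + -1) ^ 2 = 2 ^ 2 * (t * (1 - t)) := by ring
  rw [this, Real.sqrt_mul (by norm_num), Real.sqrt_sq (by norm_num), mul_inv]
  ring_nf

theorem integral_comp_cos_zero_two_pi {g : ℝ → ℝ} (hg : Continuous fun θ ↦ g (Real.cos θ)) :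
    ∫ θ in (0 : ℝ)..2 * Real.pi, g (Real.cos θ) = 2 * ∫ θ in (0 : ℝ)..Real.pi, g (Real.cos θ) := by
  rw [← intervalIntegral.integral_add_adjacent_intervals (b := Real.pi)
    (hg.intervalIntegrable _ _) (hg.intervalIntegrable _ _), two_mul (∫ _ in _.._, _),
    add_right_inj]
  have := intervalIntegral.integral_comp_sub_left (fun θ ↦ g (Real.cos θ)) (2 * Real.pi)
    (a := 0) (b := Real.pi)
  simp only [Real.cos_two_pi_sub] at this
  rw [this, sub_zero, show 2 * Real.pi - Real.pi = Real.pi by ring]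

open Complex in
theorem hasSum_ascPochhammer_div_factorial_mul_pow (a : ℝ) {z : ℂ} (hz : ‖z‖ < 1) :
    HasSum (fun k : ℕ ↦ (((ascPochhammer ℝ k).eval a / (k.factorial : ℝ) : ℝ) : ℂ) * z ^ k)
      (1 / (1 - z) ^ (a : ℂ)) := by
  have h := (one_div_one_sub_cpow_hasFPowerSeriesOnBall_zero a).hasSum (y := z)
    (by simpa [enorm_eq_nnnorm, ← NNReal.coe_lt_coe] using hz)
  simp only [← Ring.choose_add_natCast_sub_one, ofReal_choose]
  simpa [mul_comm] using h

theorem Complex.norm_one_sub_ofReal_mul_exp_sq (r θ : ℝ) :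
    ‖1 - r * exp (θ * I)‖ ^ 2 = 1 + r ^ 2 - 2 * r * Real.cos θ := by
  rw [← normSq_eq_norm_sq, exp_mul_I, ← ofReal_cos, ← ofReal_sin, normSq_apply]
  simp only [sub_re, sub_im, one_re, one_im, add_re, add_im, ofReal_re,
    ofReal_im, mul_re, mul_im, I_re, I_im]
  linear_combination r ^ 2 * Real.sin_sq_add_cos_sq θ

/-- For `c > 0`, `n > c`,
`S_{n,c}(x) = (1/π) ∫_0^1 (t+(1-t)(1+2cx)²)^{-n/c} dt/√(t(1-t))`. -/
theorem stmt_3 (c n : ℝ) (hc : 0 < c) (hn : c < n) (x : ℝ) (hx : 0 ≤ x) :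
    (∑' k : ℕ,
      ((ascPochhammer ℝ k).eval (n / c) / (k.factorial : ℝ) * (c * x) ^ k *
          (1 + c * x) ^ (-(n / c) - (k : ℝ))) ^ 2) =
    (1 / Real.pi) * ∫ t in (0:ℝ)..1,
      (t + (1 - t) * (1 + 2 * c * x) ^ 2) ^ (-(n / c)) / Real.sqrt (t * (1 - t)) := by
  have ha : 0 < n / c := div_pos (hc.trans hn) hc
  have hy : 0 ≤ c * x := by positivity
  rw [mul_assoc 2 c x]
  generalize n / c = a at ha ⊢
  generalize c * x = y at hy ⊢
  have hy1 : 0 < 1 + y := by positivity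
  obtain ⟨r, hr⟩ : ∃ r, r = y / (1 + y) := ⟨_, rfl⟩
  have hr0 : 0 ≤ r := hr ▸ by positivity
  have hr1 : r < 1 := by rw [hr, div_lt_one hy1]; linarith
  let b : ℕ → ℂ := fun k ↦
    (((ascPochhammer ℝ k).eval a / (k.factorial : ℝ) * r ^ k : ℝ) : ℂ)
  have hb : Summable fun k ↦ ‖b k‖ := by
    have := (hasSum_ascPochhammer_div_factorial_mul_pow a (z := r)
      (by simpa [abs_of_nonneg hr0] using hr1)).summable.norm
    simpa [b] using this
  have hF : ∀ θ : ℝ, HasSum (fun k ↦ b k * Complex.exp (θ * Complex.I) ^ k)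
      (1 / (1 - r * Complex.exp (θ * Complex.I)) ^ (a : ℂ)) := by
    intro θ
    have := hasSum_ascPochhammer_div_factorial_mul_pow a
      (z := r * Complex.exp (θ * Complex.I))
      (by simpa [Complex.norm_exp_ofReal_mul_I, abs_of_nonneg hr0] using hr1)
    simpa [b, mul_pow, mul_assoc] using this
  have hpar := (hasSum_sq_norm_of_summable_norm hb hF).mul_left ((1 + y) ^ (-a) * (1 + y) ^ (-a))
  let q : ℝ → ℝ := fun t ↦ t + (1 - t) * (1 + 2 * y) ^ 2
  have hq : ∀ θ : ℝ, q ((1 + Real.cos θ) / 2) =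
      (1 + y) * (1 + y) * ‖1 - r * Complex.exp (θ * Complex.I)‖ ^ 2 := by
    intro θ
    rw [Complex.norm_one_sub_ofReal_mul_exp_sq, hr]
    simp only [q]
    field_simp
    ring
  have hqpos : ∀ θ : ℝ, 0 < q ((1 + Real.cos θ) / 2) := by
    intro θ
    simp only [q]
    nlinarith [Real.cos_le_one θ, Real.neg_one_le_cos θ,
      mul_nonneg (sub_nonneg.2 (Real.cos_le_one θ)) (by positivity : 0 ≤ y + y ^ 2)]
  have hint : ∀ θ : ℝ, (1 + y) ^ (-a) * (1 + y) ^ (-a) *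
      ‖1 / (1 - r * Complex.exp (θ * Complex.I)) ^ (a : ℂ)‖ ^ 2 =
      q ((1 + Real.cos θ) / 2) ^ (-a) := by
    intro θ
    rw [hq, Real.mul_rpow (by positivity) (by positivity), Real.mul_rpow hy1.le hy1.le,
      norm_div, norm_one, Complex.norm_cpow_real, ← Real.rpow_natCast _ 2, ← Real.rpow_natCast _ 2,
      one_div, ← Real.rpow_neg (norm_nonneg _), ← Real.rpow_mul (norm_nonneg _),
      ← Real.rpow_mul (norm_nonneg _), mul_comm (-a)]
  have hcont : Continuous fun θ ↦ q ((1 + Real.cos θ) / 2) ^ (-a) :=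
    Continuous.rpow_const (by fun_prop) fun θ ↦ .inl (hqpos θ).ne'
  rw [mul_left_comm, ← intervalIntegral.integral_const_mul] at hpar
  simp only [hint] at hpar
  rw [integral_comp_cos_zero_two_pi (g := fun u ↦ q ((1 + u) / 2) ^ (-a)) hcont,
    integral_comp_cos_eq_integral_div_sqrt fun t ↦ q t ^ (-a)] at hpar
  convert hpar.tsum_eq using 1
  · congr with k
    simp only [b, Complex.norm_real, Real.norm_eq_abs, sq_abs]
    rw [Real.rpow_sub hy1, Real.rpow_natCast, hr, div_pow]
    ring
  · field_simp
    rfl
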